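/- arXiv:2409.11199 — 8 statements merged into one kernel-verified Lean document; each statement's English description precedes it below -/
import Mathlib

section
/- Let x and y be decisions such that x lexicographically strictly precedes y, i.e., there exists an index j < N with r_i(x) = r_i(y) for all i < j and r_j(x) < r_j(y). Then there exists Λ > 0 such that f(x, λ) < f(y, λ) for all λ ≥ Λ. -/
open Filter Finset

/-- If `x` lexicographically strictly precedes `y`
(equal rule values below `j`, and `r j x < r j y`), then there is `Λ > 0`
such that `f x λ < f y λ` for all `λ ≥ Λ`, where
`f z λ = ∑ i, λ^(N-i) * r i z`. -/
theorem stmt1 {X : Type*} (N : ℕ) (hN : 0 < N) (r : Fin N → X → ℝ)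
    (hr : ∀ i z, 0 ≤ r i z) (x y : X) (j : Fin N)
    (heq : ∀ i < j, r i x = r i y) (hj : r j x < r j y) :
    ∃ Λ > (0 : ℝ), ∀ l ≥ Λ,
      (∑ i, l ^ (N - i.val) * r i x) < ∑ i, l ^ (N - i.val) * r i y := by
  have hd : 0 < r j y - r j x := sub_pos.mpr hj
  have hS : 0 ≤ ∑ i, r i x := Finset.sum_nonneg fun i _ => hr i x
  have hq : 0 ≤ (∑ i, r i x) / (r j y - r j x) := div_nonneg hS hd.le
  refine ⟨1 + (∑ i, r i x) / (r j y - r j x), by linarith, fun l hl => ?_⟩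
  have hl1 : 1 ≤ l := by linarith
  have hlead : ∑ i, r i x < l * (r j y - r j x) := by
    rw [← div_lt_iff₀ hd]
    linarith
  have hp : 0 < l ^ (N - j.val - 1) := by positivity
  have hsucc : l ^ (N - j.val) = l ^ (N - j.val - 1) * l := by
    rw [← pow_succ]
    congr 1
    have := j.isLt
    omega
  have hterm : ∀ i, l ^ (N - i.val) * r i x ≤ l ^ (N - i.val) * r i y +
      l ^ (N - j.val - 1) * r i x -
        if i = j then l ^ (N - j.val) * (r j y - r j x) else 0 := by
    intro i
    have hx := mul_nonneg hp.le (hr i x)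
    rcases lt_trichotomy i j with h | rfl | h
    · rw [if_neg h.ne, heq i h]
      rw [heq i h] at hx
      linarith
    · rw [if_pos rfl]
      linarith
    · rw [if_neg h.ne']
      have hpow : l ^ (N - i.val) ≤ l ^ (N - j.val - 1) :=
        pow_le_pow_right₀ hl1 (by have : j.val < i.val := h; omega)
      have hle := mul_le_mul_of_nonneg_right hpow (hr i x)
      have hy : 0 ≤ l ^ (N - i.val) * r i y := mul_nonneg (by positivity) (hr i y)
      linarith
  calc ∑ i, l ^ (N - i.val) * r i x
      ≤ ∑ i, (l ^ (N - i.val) * r i y + l ^ (N - j.val - 1) * r i x -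
          if i = j then l ^ (N - j.val) * (r j y - r j x) else 0) :=
        Finset.sum_le_sum fun i _ => hterm i
    _ = ∑ i, l ^ (N - i.val) * r i y +
          l ^ (N - j.val - 1) * (∑ i, r i x - l * (r j y - r j x)) := by
        rw [Finset.sum_sub_distrib, Finset.sum_add_distrib, ← Finset.mul_sum,
          Finset.sum_ite_eq' Finset.univ j, if_pos (Finset.mem_univ j), hsucc]
        ring
    _ < ∑ i, l ^ (N - i.val) * r i y := by
        have := mul_neg_of_pos_of_neg hp (sub_neg.mpr hlead)
        linarith
end

section
/- Let x and y be decisions and j < N an index such that r_i(x) = 0 and r_i(y) = 0 for all i < j, and r_j(y) > 0. Then f(x, λ) / f(y, λ) tends to r_j(x) / r_j(y) as λ → +∞. -/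
open Filter Finset

/-- A polynomial sum with leading index `j`, divided by the corresponding power, tends to its
leading coefficient. -/
theorem tendsto_sum_pow_mul_div_pow {N : ℕ} (a : Fin N → ℝ) (j : Fin N)
    (ha : ∀ i < j, a i = 0) :
    Tendsto (fun l : ℝ => (∑ i, l ^ (N - i.val) * a i) / l ^ (N - j.val)) atTop
      (nhds (a j)) := by
  have hterm : ∀ i ∈ (Finset.univ : Finset (Fin N)),
      Tendsto (fun l : ℝ => l ^ (N - i.val) * a i / l ^ (N - j.val)) atTop
        (nhds (if i = j then a i else 0)) := by
    intro i _
    rcases lt_trichotomy i j with h | rfl | h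
    · simp [ha i h]
    · rw [if_pos rfl]
      refine tendsto_const_nhds.congr' ?_
      filter_upwards [eventually_gt_atTop (0 : ℝ)] with l hl
      field_simp
    · rw [if_neg h.ne']
      have hpow : N - i.val < N - j.val := by omega
      simpa [div_mul_eq_mul_div] using
        (tendsto_pow_div_pow_atTop_zero (𝕜 := ℝ) hpow).mul_const (a i)
  simpa [Finset.sum_div] using tendsto_finsetSum _ hterm

/-- If `r i x = 0 = r i y` for all `i < j` and `r j y > 0`, then
`f x λ / f y λ → r j x / r j y` as `λ → +∞`, where
`f z λ = ∑ i, λ^(N-i) * r i z`. -/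
theorem stmt2 {X : Type*} (N : ℕ) (hN : 0 < N) (r : Fin N → X → ℝ)
    (hr : ∀ i z, 0 ≤ r i z) (x y : X) (j : Fin N)
    (hx0 : ∀ i < j, r i x = 0) (hy0 : ∀ i < j, r i y = 0) (hyj : 0 < r j y) :
    Tendsto
      (fun l : ℝ =>
        (∑ i, l ^ (N - i.val) * r i x) / (∑ i, l ^ (N - i.val) * r i y))
      atTop (nhds (r j x / r j y)) := by
  refine ((tendsto_sum_pow_mul_div_pow (fun i => r i x) j hx0).div
    (tendsto_sum_pow_mul_div_pow (fun i => r i y) j hy0) hyj.ne').congr' ?_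
  filter_upwards [eventually_gt_atTop (0 : ℝ)] with l hl
  exact div_div_div_cancel_right₀ (pow_pos hl _).ne' _ _
end

section
/- Let x and y be decisions, let j < N be such that r_i(y) = 0 for all i < j and r_j(y) > 0 (so y has rank j), and suppose r_i(x) = 0 for all i ≤ j (so the rank of x is strictly greater than j). Then f(x, λ) / f(y, λ) tends to 0 as λ → +∞. -/
open Filter Finset

/-- If `y` has rank `j` (`r i y = 0` for `i < j`, `r j y > 0`) and
`r i x = 0` for all `i ≤ j` (so `x` has strictly larger rank), then
`f x λ / f y λ → 0` as `λ → +∞`. -/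
theorem stmt6 {X : Type*} (N : ℕ) (hN : 0 < N) (r : Fin N → X → ℝ)
    (hr : ∀ i z, 0 ≤ r i z) (x y : X) (j : Fin N)
    (hy0 : ∀ i < j, r i y = 0) (hyj : 0 < r j y)
    (hx0 : ∀ i ≤ j, r i x = 0) :
    Tendsto
      (fun l : ℝ =>
        (∑ i, l ^ (N - i.val) * r i x) / (∑ i, l ^ (N - i.val) * r i y))
      atTop (nhds 0) := by
  have hlim : Tendsto (fun l : ℝ => (∑ i, r i x) / r j y / l) atTop (nhds 0) :=
    tendsto_const_nhds.div_atTop tendsto_id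
  refine tendsto_of_tendsto_of_tendsto_of_le_of_le' tendsto_const_nhds hlim ?_ ?_
  · filter_upwards [eventually_ge_atTop (1 : ℝ)] with l hl
    exact div_nonneg
      (Finset.sum_nonneg fun i _ => mul_nonneg (by positivity) (hr i x))
      (Finset.sum_nonneg fun i _ => mul_nonneg (by positivity) (hr i y))
  · filter_upwards [eventually_ge_atTop (1 : ℝ)] with l hl
    have hl0 : 0 < l := by linarith
    have hjN := j.isLt
    have hnum : ∑ i, l ^ (N - i.val) * r i x ≤ l ^ (N - j.val - 1) * ∑ i, r i x := by
      rw [Finset.mul_sum]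
      refine Finset.sum_le_sum fun i _ => ?_
      rcases le_or_gt i j with hij | hij
      · simp [hx0 i hij]
      · have hij' : j.val < i.val := hij
        exact mul_le_mul_of_nonneg_right (pow_le_pow_right₀ hl (by omega)) (hr i x)
    have hden : l ^ (N - j.val) * r j y ≤ ∑ i, l ^ (N - i.val) * r i y :=
      Finset.single_le_sum (f := fun i : Fin N => l ^ (N - i.val) * r i y)
        (fun i _ => mul_nonneg (by positivity) (hr i y)) (Finset.mem_univ j)
    have hpow : l ^ (N - j.val) = l ^ (N - j.val - 1) * l := by
      rw [← pow_succ]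
      congr 1
      omega
    have hsum : 0 ≤ ∑ i, r i x := Finset.sum_nonneg fun i _ => hr i x
    calc (∑ i, l ^ (N - i.val) * r i x) / (∑ i, l ^ (N - i.val) * r i y)
        ≤ (l ^ (N - j.val - 1) * ∑ i, r i x) / (l ^ (N - j.val) * r j y) :=
          div_le_div₀ (by positivity) hnum (by positivity) hden
      _ = (∑ i, r i x) / r j y / l := by
          rw [hpow]
          field_simp
end

section
/- Let x ∈ E have rank j, i.e., r_i(x) = 0 for all i < j and r_j(x) > 0, and assume each r_i is differentiable at x and satisfies r_i(x) = 0 → Dr_i(x) = 0. Then the Fréchet derivative of z ↦ f(z, λ) at x equals λ^{N−j} · Dr_j(x) + ε(λ), where ε(λ) = Σ_{i=j+1}^{N−1} λ^{N−i} · Dr_i(x), and ‖ε(λ)‖ / λ^{N−j} tends to 0 as λ → +∞. -/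
open Filter Finset

/-- If `x` has rank `j` and each rule `r i` has Fréchet derivative
`D i` at `x` with the stationarity property `r i x = 0 → D i = 0`, then for
every `λ > 0` the Fréchet derivative of `z ↦ f z λ` at `x` is
`λ^(N-j) • D j + ε λ` where `ε λ = ∑_{i > j} λ^(N-i) • D i`, and
`‖ε λ‖ / λ^(N-j) → 0` as `λ → +∞`. -/
theorem stmt7 {E : Type*} [NormedAddCommGroup E] [NormedSpace ℝ E]
    (N : ℕ) (hN : 0 < N) (r : Fin N → E → ℝ) (hr : ∀ i z, 0 ≤ r i z)
    (x : E) (j : Fin N) (hx0 : ∀ i < j, r i x = 0) (hxj : 0 < r j x)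
    (D : Fin N → E →L[ℝ] ℝ) (hD : ∀ i, HasFDerivAt (r i) (D i) x)
    (hstat : ∀ i, r i x = 0 → D i = 0) :
    (∀ l : ℝ, 0 < l →
      HasFDerivAt (fun z : E => ∑ i, l ^ (N - i.val) * r i z)
        (l ^ (N - j.val) • D j +
          ∑ i ∈ Finset.univ.filter (fun i => j < i), l ^ (N - i.val) • D i) x)
    ∧ Tendsto
        (fun l : ℝ =>
          ‖∑ i ∈ Finset.univ.filter (fun i => j < i), l ^ (N - i.val) • D i‖ /
            l ^ (N - j.val))
        atTop (nhds 0) := by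
  refine ⟨fun l _ => ?_, ?_⟩
  · have h : HasFDerivAt (fun z : E => ∑ i, l ^ (N - i.val) * r i z)
        (∑ i, l ^ (N - i.val) • D i) x :=
      HasFDerivAt.fun_sum fun i _ => (hD i).const_mul _
    convert h using 1
    have hj : j ∉ Finset.univ.filter (fun i => j < i) := by simp
    rw [← Finset.sum_insert (f := fun i : Fin N => l ^ (N - i.val) • D i) hj]
    refine Finset.sum_subset (Finset.subset_univ _) fun i _ hi => ?_
    have hij : i < j := by
      simp only [Finset.mem_insert, Finset.mem_filter, Finset.mem_univ, true_and, not_or,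
        not_lt] at hi
      exact lt_of_le_of_ne hi.2 hi.1
    rw [hstat i (hx0 i hij), smul_zero]
  · have h : Tendsto (fun l : ℝ => ∑ i ∈ Finset.univ.filter (fun i => j < i),
        (l ^ (N - i.val) / l ^ (N - j.val)) • D i) atTop (nhds 0) := by
      rw [← Finset.sum_const_zero (s := Finset.univ.filter (fun i => j < i))]
      refine tendsto_finsetSum _ fun i hi => ?_
      have hij : j.val < i.val := by simpa using hi
      have hlt : N - i.val < N - j.val := by omega
      simpa using (tendsto_pow_div_pow_atTop_zero (𝕜 := ℝ) hlt).smul_const (D i)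
    refine (tendsto_zero_iff_norm_tendsto_zero.mp h).congr' ?_
    filter_upwards [eventually_gt_atTop 0] with l hl
    simp_rw [div_eq_inv_mul, mul_smul, ← Finset.smul_sum]
    rw [norm_smul, norm_inv, Real.norm_of_nonneg (pow_pos hl _).le]
end

section
/- Let x ∈ E have rank j, i.e., r_i(x) = 0 for all i < j and r_j(x) > 0, and assume each r_i is differentiable at x and satisfies r_i(x) = 0 → Dr_i(x) = 0. Then ‖D_z f(z, λ)|_{z=x}‖ / λ^{N−j} tends to ‖Dr_j(x)‖ as λ → +∞, where D_z f(z, λ)|_{z=x} denotes the Fréchet derivative of z ↦ f(z, λ) at x. -/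
open Filter Finset

/-- If `x` has rank `j`, each `r i` is differentiable at `x`, and
`r i x = 0 → fderiv ℝ (r i) x = 0`, then
`‖fderiv ℝ (f · λ) x‖ / λ^(N-j) → ‖fderiv ℝ (r j) x‖` as `λ → +∞`. -/
theorem stmt8 {E : Type*} [NormedAddCommGroup E] [NormedSpace ℝ E]
    (N : ℕ) (hN : 0 < N) (r : Fin N → E → ℝ) (hr : ∀ i z, 0 ≤ r i z)
    (x : E) (j : Fin N) (hx0 : ∀ i < j, r i x = 0) (hxj : 0 < r j x)
    (hdiff : ∀ i, DifferentiableAt ℝ (r i) x)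
    (hstat : ∀ i, r i x = 0 → fderiv ℝ (r i) x = 0) :
    Tendsto
      (fun l : ℝ =>
        ‖fderiv ℝ (fun z : E => ∑ i, l ^ (N - i.val) * r i z) x‖ /
          l ^ (N - j.val))
      atTop (nhds ‖fderiv ℝ (r j) x‖) := by
  have hder : ∀ l : ℝ, fderiv ℝ (fun z : E => ∑ i, l ^ (N - i.val) * r i z) x =
      ∑ i, l ^ (N - i.val) • fderiv ℝ (r i) x := fun l =>
    (HasFDerivAt.fun_sum fun i _ => (hdiff i).hasFDerivAt.const_mul (l ^ (N - i.val))).fderiv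
  have hterm : ∀ i : Fin N, Tendsto
      (fun l : ℝ => (l ^ (N - i.val) / l ^ (N - j.val)) • fderiv ℝ (r i) x) atTop
      (nhds (if i = j then fderiv ℝ (r i) x else 0)) := by
    intro i
    rcases lt_trichotomy i j with hij | rfl | hij
    · simp [hstat i (hx0 i hij)]
    · rw [if_pos rfl]
      refine tendsto_const_nhds.congr' ?_
      filter_upwards [eventually_gt_atTop 0] with l hl
      rw [div_self (pow_pos hl _).ne', one_smul]
    · rw [if_neg hij.ne']
      have hlt : N - i.val < N - j.val := by
        have := i.isLt
        have : j.val < i.val := hij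
        omega
      simpa using (tendsto_pow_div_pow_atTop_zero (𝕜 := ℝ) hlt).smul_const (fderiv ℝ (r i) x)
  have hsum := (tendsto_finsetSum univ fun i _ => hterm i).norm
  rw [Finset.sum_ite_eq' univ j, if_pos (mem_univ j)] at hsum
  refine hsum.congr' ?_
  filter_upwards [eventually_gt_atTop 0] with l hl
  have hpos : 0 < l ^ (N - j.val) := pow_pos hl _
  rw [hder, div_eq_inv_mul, ← Real.norm_of_nonneg (inv_nonneg.2 hpos.le), ← norm_smul,
    Finset.smul_sum]
  simp only [smul_smul, div_eq_inv_mul]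
end

section
/- Let x ∈ E have rank j with r_j(x) > 0, assume each r_i is differentiable at x with the stationarity property Dr_i(x) = 0 ↔ r_i(x) = 0 (so in particular r_i(x) = 0 and Dr_i(x) = 0 for all i < j, and Dr_j(x) ≠ 0). Then there exists Λ > 0 such that for every λ ≥ Λ, the Fréchet derivative of z ↦ f(z, λ) at x is nonzero; i.e., x is not a stationary point of f(·, λ) for all sufficiently large λ. -/
open Filter Finset

/-- A polynomial whose monomials have the distinct degrees `N - i` is nonzero as soon as one of
its coefficients is. -/
theorem sum_monomial_ne_zero {R : Type*} [Semiring R] {N : ℕ} (c : Fin N → R) {j : Fin N}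
    (hj : c j ≠ 0) : ∑ i, Polynomial.monomial (N - i.val) (c i) ≠ 0 := by
  intro h
  have hc := congrArg (fun p => Polynomial.coeff p (N - j.val)) h
  simp only [Polynomial.finsetSum_coeff, Polynomial.coeff_monomial, Polynomial.coeff_zero] at hc
  rw [Finset.sum_eq_single j (fun i _ hij => if_neg (by omega)) (by simp)] at hc
  exact hj (by simpa using hc)

/-- If `x` has rank `j` with `r j x > 0`, each `r i` is
differentiable at `x`, and `fderiv ℝ (r i) x = 0 ↔ r i x = 0`, then there is
`Λ > 0` such that for every `λ ≥ Λ` the Fréchet derivative of `z ↦ f z λ`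
at `x` is nonzero. -/
theorem stmt9 {E : Type*} [NormedAddCommGroup E] [NormedSpace ℝ E]
    (N : ℕ) (hN : 0 < N) (r : Fin N → E → ℝ) (hr : ∀ i z, 0 ≤ r i z)
    (x : E) (j : Fin N) (hx0 : ∀ i < j, r i x = 0) (hxj : 0 < r j x)
    (hdiff : ∀ i, DifferentiableAt ℝ (r i) x)
    (hstat : ∀ i, fderiv ℝ (r i) x = 0 ↔ r i x = 0) :
    ∃ Λ > (0 : ℝ), ∀ l ≥ Λ,
      fderiv ℝ (fun z : E => ∑ i, l ^ (N - i.val) * r i z) x ≠ 0 := by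
  have hD : fderiv ℝ (r j) x ≠ 0 := fun h => hxj.ne' ((hstat j).1 h)
  obtain ⟨v, hv⟩ : ∃ v, fderiv ℝ (r j) x v ≠ 0 := by
    by_contra! h
    exact hD (ContinuousLinearMap.ext h)
  have hp := sum_monomial_ne_zero (fun i => fderiv ℝ (r i) x v) hv
  obtain ⟨Λ, hΛ⟩ := eventually_atTop.1 (Polynomial.eventually_atTop_not_isRoot _ hp)
  refine ⟨max Λ 1, by positivity, fun l hl h => hΛ l (le_trans (le_max_left _ _) hl) ?_⟩
  rw [fderiv_fun_sum fun i _ => (hdiff i).const_mul _] at h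
  have hsum := DFunLike.congr_fun h v
  simp only [fderiv_const_mul (hdiff _), _root_.sum_apply,
    _root_.smul_apply, smul_eq_mul, _root_.zero_apply] at hsum
  simpa [Polynomial.IsRoot.def, Polynomial.eval_finsetSum, mul_comm] using hsum
end

section
/- Let x ∈ E and assume each r_i is differentiable at x with the stationarity property Dr_i(x) = 0 ↔ r_i(x) = 0. If for every Λ > 0 there exists λ ≥ Λ with the Fréchet derivative of z ↦ f(z, λ) at x equal to zero (i.e., x is a stationary point of f(·, λ) for arbitrarily large λ), then r_i(x) = 0 for every i, i.e., x satisfies all N rules. -/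
open Filter Finset

/-- A real polynomial with arbitrarily large positive roots is zero. -/
theorem Polynomial.eq_zero_of_forall_exists_ge_isRoot (p : Polynomial ℝ)
    (h : ∀ Λ > (0 : ℝ), ∃ l ≥ Λ, p.eval l = 0) : p = 0 := by
  by_contra hp
  obtain ⟨B, hB⟩ := (Polynomial.finite_setOfPred_isRoot hp).bddAbove
  obtain ⟨l, hl, h0⟩ := h (max B 0 + 1) (by positivity)
  have : l ≤ B := hB h0
  linarith [le_max_left B 0]

/-- If each `r i` is differentiable at `x` with the stationarity
property `fderiv ℝ (r i) x = 0 ↔ r i x = 0`, and `x` is a stationary point of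
`f (·, λ)` for arbitrarily large `λ`, then `x` satisfies all rules. -/
theorem stmt10 {E : Type*} [NormedAddCommGroup E] [NormedSpace ℝ E]
    (N : ℕ) (hN : 0 < N) (r : Fin N → E → ℝ) (hr : ∀ i z, 0 ≤ r i z)
    (x : E)
    (hdiff : ∀ i, DifferentiableAt ℝ (r i) x)
    (hstat : ∀ i, fderiv ℝ (r i) x = 0 ↔ r i x = 0)
    (h : ∀ Λ > (0 : ℝ), ∃ l ≥ Λ,
      fderiv ℝ (fun z : E => ∑ i, l ^ (N - i.val) * r i z) x = 0) :
    ∀ i, r i x = 0 := by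
  intro i
  rw [← hstat]
  ext v
  have hp := Polynomial.eq_zero_of_forall_exists_ge_isRoot
    (∑ j : Fin N, Polynomial.monomial (N - j.val) (fderiv ℝ (r j) x v)) fun Λ hΛ => by
      obtain ⟨l, hl, hd⟩ := h Λ hΛ
      refine ⟨l, hl, ?_⟩
      have hf : HasFDerivAt (fun z : E => ∑ j, l ^ (N - j.val) * r j z)
          (∑ j : Fin N, l ^ (N - j.val) • fderiv ℝ (r j) x) x :=
        HasFDerivAt.fun_sum fun j _ => (hdiff j).hasFDerivAt.const_mul _
      rw [hf.fderiv] at hd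
      simpa [Polynomial.eval_finsetSum, mul_comm] using congrArg (· v) hd
  have hc := congrArg (Polynomial.coeff · (N - i.val)) hp
  simp only [Polynomial.finsetSum_coeff, Polynomial.coeff_monomial, Polynomial.coeff_zero] at hc
  rw [Finset.sum_eq_single i (fun j _ hj => if_neg (by omega)) (by simp)] at hc
  simpa using hc
end

section
/- For every integer N ≥ 2 and all reals a > 0 and c > 0, there exist vectors ρ, σ : Fin N → ℝ such that ρ is lexicographically preferred to σ (there exists an index j with ρ_i = σ_i for all i < j and ρ_j > σ_j) yet R(ρ) < R(σ), where R(ρ) = Σ_{i=0}^{N−1} ( a^{N−i} · step(c·ρ_i) + ρ_i / N ). Hence the reward function R does not represent the lexicographic preference order on robustness vectors. -/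
open Finset

/-- For every `N ≥ 2`, `a > 0`, `c > 0` there are robustness
vectors `ρ, σ : Fin N → ℝ` with `ρ` lexicographically strictly preferred to `σ`
(equal below some index `j` and `ρ j > σ j`) yet
`R ρ < R σ`, where `R ρ = ∑ i, (a^(N-i) * step (c * ρ i) + ρ i / N)` and
`step z = 1` if `z ≥ 0`, else `0`. Hence `R` does not represent the
lexicographic preference order. -/
theorem stmt11 (N : ℕ) (hN : 2 ≤ N) (a c : ℝ) (ha : 0 < a) (hc : 0 < c) :
    ∃ ρ σ : Fin N → ℝ,
      (∃ j : Fin N, (∀ i < j, ρ i = σ i) ∧ σ j < ρ j) ∧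
      (∑ i, (a ^ (N - i.val) * (if 0 ≤ c * ρ i then (1 : ℝ) else 0) + ρ i / N))
        <
      (∑ i, (a ^ (N - i.val) * (if 0 ≤ c * σ i then (1 : ℝ) else 0) + σ i / N))
      := by
  obtain ⟨n, rfl⟩ : ∃ n, N = n + 2 := ⟨N - 2, by omega⟩
  refine ⟨Fin.cons 2 (Fin.cons 0 fun _ => 0), Fin.cons 1 (Fin.cons 2 fun _ => 0),
    ⟨0, fun i hi => absurd hi (Fin.not_lt_zero i), by simp⟩, ?_⟩
  have hn : (0 : ℝ) < ((n + 2 : ℕ) : ℝ) := by positivity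
  have hsum : (2 : ℝ) / ((n + 2 : ℕ) : ℝ) < 1 / ((n + 2 : ℕ) : ℝ) + 2 / ((n + 2 : ℕ) : ℝ) := by
    have : (0 : ℝ) < 1 / ((n + 2 : ℕ) : ℝ) := by positivity
    linarith
  have hc1 : 0 ≤ c * 1 := by positivity
  have hc2 : 0 ≤ c * 2 := by positivity
  simp only [Fin.sum_univ_succ, Fin.cons_zero, Fin.cons_succ, mul_zero, le_refl, if_true,
    if_pos hc1, if_pos hc2, zero_div]
  linarith
end
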